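/- arXiv:math/0610016 — 3 statements merged into one kernel-verified Lean document; each statement's English description precedes it below -/
import Mathlib

section
/- Let N ≥ 2 and let h : ℝ^N → ℝ^N be the inversion h(y) = ‖y‖⁻² • y. Fix y ∈ ℝ^N with y ≠ 0, and let u : ℝ^N → ℝ be differentiable at h(y). Then u ∘ h is differentiable at y and ‖∇(u ∘ h)(y)‖ = ‖y‖⁻² · ‖∇u(h(y))‖, where ∇ denotes the gradient in ℝ^N. -/
open MeasureTheory Filter

theorem inversion_zero_one {F : Type*} [NormedAddCommGroup F] [InnerProductSpace ℝ F] :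
    EuclideanGeometry.inversion (0 : F) 1 = fun x => (‖x‖ ^ 2)⁻¹ • x := by
  ext1 x
  simp [EuclideanGeometry.inversion]

theorem norm_gradient {F : Type*} [NormedAddCommGroup F] [InnerProductSpace ℝ F]
    [CompleteSpace F] (f : F → ℝ) (x : F) : ‖gradient f x‖ = ‖fderiv ℝ f x‖ :=
  LinearIsometryEquiv.norm_map _ _

/-- The inversion scales gradients of compositions by the conformal factor `‖y‖⁻²`. -/
theorem stmt_1 (N : ℕ) (hN : 2 ≤ N)
    (h : EuclideanSpace ℝ (Fin N) → EuclideanSpace ℝ (Fin N))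
    (hh : h = fun x => (‖x‖ ^ 2)⁻¹ • x)
    (y : EuclideanSpace ℝ (Fin N)) (hy : y ≠ 0)
    (u : EuclideanSpace ℝ (Fin N) → ℝ)
    (hu : DifferentiableAt ℝ u (h y)) :
    DifferentiableAt ℝ (u ∘ h) y ∧
    ‖gradient (u ∘ h) y‖ = (‖y‖ ^ 2)⁻¹ * ‖gradient u (h y)‖ := by
  have hd := EuclideanGeometry.hasFDerivAt_inversion (R := 1) hy
  rw [inversion_zero_one, ← hh] at hd
  have hc := hu.hasFDerivAt.comp y hd
  refine ⟨hc.differentiableAt, ?_⟩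
  rw [norm_gradient, norm_gradient, hc.fderiv, ContinuousLinearMap.comp_smul, norm_smul,
    ContinuousLinearMap.opNorm_comp_linearIsometryEquiv]
  simp
end

section
/- Let p > 1 be a real number and k ≥ 1 an integer. Then there exists a unique real number β ≥ 1 such that (2k-1)·β² - ((p·k² + (p-2)·(2k-1))/(p-1))·β + k² = 0. -/
/-- If `0 < a ≤ c`, `a + c ≤ b`, with `b = a + c` only when `a = c`, then
`a X² - b X + c` has exactly one root in `[1, ∞)`. -/
lemma existsUnique_one_le_quadratic_root {a b c : ℝ} (ha : 0 < a) (hac : a ≤ c)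
    (hb : a + c ≤ b) (heq : b = a + c → c = a) :
    ∃! x : ℝ, 1 ≤ x ∧ a * x ^ 2 - b * x + c = 0 := by
  have hD : 0 ≤ b ^ 2 - 4 * a * c := by nlinarith [sq_nonneg (a - c)]
  refine existsUnique_of_exists_of_unique
    ⟨(b + √(b ^ 2 - 4 * a * c)) / (2 * a), ?_, ?_⟩ ?_
  · rw [le_div_iff₀ (by positivity)]
    linarith [Real.sqrt_nonneg (b ^ 2 - 4 * a * c)]
  · have hs := Real.sq_sqrt hD
    generalize √(b ^ 2 - 4 * a * c) = s at hs ⊢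
    field_simp
    linear_combination hs
  · rintro x y ⟨hx, hfx⟩ ⟨hy, hfy⟩
    by_contra hne
    have hsum : a * (x + y) = b := by
      apply mul_left_cancel₀ (sub_ne_zero.mpr hne)
      linear_combination hfx - hfy
    have hprod : a * (x * y) = c := by
      linear_combination x * hsum - hfx
    have hnonneg : 0 ≤ a * ((x - 1) * (y - 1)) :=
      mul_nonneg ha.le (mul_nonneg (by linarith) (by linarith))
    have hbac : b = a + c := by linarith
    have hca := heq hbac
    have hxy : x + y = 2 := by
      apply mul_left_cancel₀ ha.ne'
      linarith
    exact hne (by linarith)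

/-- The algebraic part of Krol's theorem: the quadratic
`(2k-1)X² - ((pk² + (p-2)(2k-1))/(p-1))X + k² = 0` has a unique root `β ≥ 1`. -/
theorem stmt_12 (p : ℝ) (hp : 1 < p) (k : ℕ) (hk : 1 ≤ k) :
    ∃! β : ℝ, 1 ≤ β ∧
      (2 * (k : ℝ) - 1) * β ^ 2
        - ((p * (k : ℝ) ^ 2 + (p - 2) * (2 * (k : ℝ) - 1)) / (p - 1)) * β
        + (k : ℝ) ^ 2 = 0 := by
  have hk' : (1 : ℝ) ≤ k := by exact_mod_cast hk
  have hp' : 0 < p - 1 := by linarith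
  apply existsUnique_one_le_quadratic_root
  · linarith
  · nlinarith [sq_nonneg ((k : ℝ) - 1)]
  · rw [le_div_iff₀ hp']
    nlinarith [sq_nonneg ((k : ℝ) - 1)]
  · intro h
    rw [div_eq_iff hp'.ne'] at h
    linear_combination h
end

section
/- Let p > 1 be a real number, k ≥ 1 an integer, and let β_k be the unique root ≥ 1 of (2k-1)X² - ((pk² + (p-2)(2k-1))/(p-1))X + k² = 0. Then there exists an infinitely differentiable function ω : ℝ → ℝ such that: (i) β_k²·ω(θ)² + ω'(θ)² > 0 for all θ ∈ ℝ; (ii) ω solves the ordinary differential equation -(d/dθ)[(β_k²ω² + ω'²)^((p-2)/2) ω'] = β_k(1 + (β_k - 1)(p-1)) (β_k²ω² + ω'²)^((p-2)/2) ω on ℝ; (iii) π/k is an antiperiod of ω, i.e. ω(θ + π/k) = -ω(θ) for all θ; and (iv) π/k is the least positive antiperiod: there is no T with 0 < T < π/k and ω(θ + T) = -ω(θ) for all θ. -/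
namespace KrolODE

open Real

/-- The quadratic form `A cos² φ + B sin² φ`. -/
noncomputable def quad (A B φ : ℝ) : ℝ := A * cos φ ^ 2 + B * sin φ ^ 2

lemma quad_pos {A B : ℝ} (hA : 0 < A) (hB : 0 < B) (φ : ℝ) : 0 < quad A B φ := by
  have h := sin_sq_add_cos_sq φ
  unfold quad
  rcases eq_or_ne (sin φ) 0 with h0 | h0
  · have : cos φ ^ 2 = 1 := by rw [h0] at h; linarith
    rw [this, h0]; linarith
  · have : 0 < sin φ ^ 2 := by positivity
    positivity

lemma quad_add_pi (A B φ : ℝ) : quad A B (φ + π) = quad A B φ := by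
  simp [quad]

lemma hasDerivAt_quad (A B φ : ℝ) :
    HasDerivAt (quad A B) (2 * (B - A) * (sin φ * cos φ)) φ := by
  have h := (((hasDerivAt_cos φ).pow 2).const_mul A).add (((hasDerivAt_sin φ).pow 2).const_mul B)
  refine h.congr_deriv ?_
  norm_num
  ring

lemma contDiff_quad (A B : ℝ) {n : WithTop ℕ∞} : ContDiff ℝ n (quad A B) :=
  (contDiff_const.mul (contDiff_cos.pow 2)).add (contDiff_const.mul (contDiff_sin.pow 2))

/-- The `π`-periodic part of the primitive of `φ ↦ a b / (a² cos² φ + b² sin² φ)`. -/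
noncomputable def phaseShift (a b φ : ℝ) : ℝ :=
  arctan ((b - a) * (sin φ * cos φ) / quad a b φ)

lemma phaseShift_add_pi (a b φ : ℝ) : phaseShift a b (φ + π) = phaseShift a b φ := by
  simp [phaseShift, quad_add_pi]

lemma contDiff_phaseShift {a b : ℝ} (ha : 0 < a) (hb : 0 < b) {n : WithTop ℕ∞} :
    ContDiff ℝ n (phaseShift a b) :=
  contDiff_arctan.comp ((contDiff_const.mul (contDiff_sin.mul contDiff_cos)).div
    (contDiff_quad a b) fun φ => (quad_pos ha hb φ).ne')

lemma hasDerivAt_phaseShift {a b : ℝ} (ha : 0 < a) (hb : 0 < b) (φ : ℝ) :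
    HasDerivAt (phaseShift a b) (a * b / quad (a ^ 2) (b ^ 2) φ - 1) φ := by
  have hv := quad_pos ha hb φ
  have hq := quad_pos (pow_pos ha 2) (pow_pos hb 2) φ
  have h := ((((hasDerivAt_sin φ).mul (hasDerivAt_cos φ)).const_mul (b - a)).div
    (hasDerivAt_quad a b φ) hv.ne').arctan
  have hsum : quad a b φ ^ 2 + ((b - a) * (sin φ * cos φ)) ^ 2 = quad (a ^ 2) (b ^ 2) φ := by
    unfold quad
    linear_combination (a ^ 2 * cos φ ^ 2 + b ^ 2 * sin φ ^ 2) * sin_sq_add_cos_sq φ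
  refine h.congr_deriv ?_
  have h1 : 1 + ((b - a) * (sin φ * cos φ) / quad a b φ) ^ 2
      = quad (a ^ 2) (b ^ 2) φ / quad a b φ ^ 2 := by
    rw [← hsum]; field_simp
  simp only [Pi.mul_apply, Pi.div_apply]
  rw [h1]
  field_simp
  unfold quad
  linear_combination ((b - a) * (a * cos φ ^ 2 - b * sin φ ^ 2) + a * b) * sin_sq_add_cos_sq φ

/-- The polar angle as a reparametrisation of the line: `φ ↦ φ - m (φ + phaseShift a b φ)`. -/
noncomputable def angle (m a b φ : ℝ) : ℝ := φ - m * (φ + phaseShift a b φ)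

lemma angle_zero (m a b : ℝ) : angle m a b 0 = 0 := by
  simp [angle, phaseShift]

lemma angle_add_pi (m a b φ : ℝ) : angle m a b (φ + π) = angle m a b φ + (1 - m) * π := by
  simp only [angle, phaseShift_add_pi]
  ring

lemma contDiff_angle (m : ℝ) {a b : ℝ} (ha : 0 < a) (hb : 0 < b) {n : WithTop ℕ∞} :
    ContDiff ℝ n (angle m a b) :=
  contDiff_id.sub (contDiff_const.mul (contDiff_id.add (contDiff_phaseShift ha hb)))

lemma hasDerivAt_angle (m : ℝ) {a b : ℝ} (ha : 0 < a) (hb : 0 < b) (φ : ℝ) :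
    HasDerivAt (angle m a b) (1 - m * (a * b) / quad (a ^ 2) (b ^ 2) φ) φ := by
  refine ((hasDerivAt_id φ).sub
    (((hasDerivAt_id φ).add (hasDerivAt_phaseShift ha hb φ)).const_mul m)).congr_deriv ?_
  ring

lemma surjective_angle {m a b : ℝ} (hm0 : 0 ≤ m) (hm : m < 1) (ha : 0 < a) (hb : 0 < b) :
    Function.Surjective (angle m a b) := by
  have hm' : 0 < 1 - m := by linarith
  have hbd : ∀ φ, m * phaseShift a b φ ≤ m * (π / 2) ∧ -(m * (π / 2)) ≤ m * phaseShift a b φ := by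
    intro φ
    have h1 := (arctan_lt_pi_div_two ((b - a) * (sin φ * cos φ) / quad a b φ)).le
    have h2 := (neg_pi_div_two_lt_arctan ((b - a) * (sin φ * cos φ) / quad a b φ)).le
    unfold phaseShift
    constructor <;> nlinarith
  refine (contDiff_angle m ha hb (n := 0)).continuous.surjective ?_ ?_
  · refine Filter.tendsto_atTop_mono (f := fun φ => (1 - m) * φ + -(m * (π / 2))) (fun φ => ?_)
      (Filter.tendsto_atTop_add_const_right _ _ (Filter.tendsto_id.const_mul_atTop hm'))
    have := (hbd φ).1
    unfold angle
    linarith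
  · refine Filter.tendsto_atBot_mono (f := fun φ => (1 - m) * φ + m * (π / 2)) (fun φ => ?_)
      (Filter.tendsto_atBot_add_const_right _ _ (Filter.tendsto_id.const_mul_atBot hm'))
    have := (hbd φ).2
    unfold angle
    linarith

/-- The inverse of `angle` is smooth, and it solves the autonomous equation of the polar angle. -/
lemma exists_polar_angle {m a b : ℝ} (hm0 : 0 ≤ m) (hm : m < 1) (ha : 0 < a) (hb : 0 < b)
    (hD : ∀ φ, 0 < quad (a ^ 2) (b ^ 2) φ - m * (a * b)) :
    ∃ Φ : ℝ → ℝ, ContDiff ℝ (⊤ : ℕ∞) Φ ∧ StrictMono Φ ∧ Φ 0 = 0 ∧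
      (∀ θ, Φ (θ + (1 - m) * π) = Φ θ + π) ∧
      ∀ θ, HasDerivAt Φ
        (quad (a ^ 2) (b ^ 2) (Φ θ) / (quad (a ^ 2) (b ^ 2) (Φ θ) - m * (a * b))) θ := by
  have hq := quad_pos (pow_pos ha 2) (pow_pos hb 2)
  have hpos : ∀ φ, 0 < 1 - m * (a * b) / quad (a ^ 2) (b ^ 2) φ := by
    intro φ
    have : 1 - m * (a * b) / quad (a ^ 2) (b ^ 2) φ
        = (quad (a ^ 2) (b ^ 2) φ - m * (a * b)) / quad (a ^ 2) (b ^ 2) φ := by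
      have := (hq φ).ne'
      field_simp
    rw [this]
    exact div_pos (hD φ) (hq φ)
  have hderiv := hasDerivAt_angle m ha hb
  have hmono : StrictMono (angle m a b) :=
    strictMono_of_deriv_pos fun φ => by rw [(hderiv φ).deriv]; exact hpos φ
  let e : ℝ ≃o ℝ := hmono.orderIsoOfSurjective _ (surjective_angle hm0 hm ha hb)
  have he : ∀ φ, e φ = angle m a b φ := fun _ => rfl
  refine ⟨e.symm, ?_, e.symm.strictMono, ?_, fun θ => ?_, fun θ => ?_⟩
  · exact e.toHomeomorph.contDiff_symm_deriv (fun φ => (hpos φ).ne') hderiv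
      (contDiff_angle m ha hb)
  · rw [OrderIso.symm_apply_eq, he, angle_zero]
  · rw [OrderIso.symm_apply_eq, he, angle_add_pi, ← he, e.apply_symm_apply]
  · have h := HasDerivAt.of_local_left_inverse (f := e) (g := e.symm)
      e.symm.continuous.continuousAt (hderiv (e.symm θ)) (hpos _).ne'
      (Filter.Eventually.of_forall e.apply_symm_apply)
    refine h.congr_deriv ?_
    have h1 := (hq (e.symm θ)).ne'
    have h2 := (hD (e.symm θ)).ne'
    rw [one_sub_div h1, inv_div]

/-- The relation `β² ω² + ω'² = R²` in polar coordinates. -/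
lemma polar_sq {β R : ℝ} (hβ : β ≠ 0) (φ : ℝ) :
    β ^ 2 * (R * sin φ / β) ^ 2 + (R * cos φ) ^ 2 = R ^ 2 := by
  field_simp
  linear_combination R ^ 2 * sin_sq_add_cos_sq φ

/-- The root equation for `β` says that one turn of the polar angle takes `1 / k` of a turn. -/
lemma sqrt_mul_sqrt_of_root {p β k : ℝ} (hp : 1 < p) (hβ : 1 ≤ β) (hk : 1 ≤ k)
    (hroot : (2 * k - 1) * β ^ 2
        - ((p * k ^ 2 + (p - 2) * (2 * k - 1)) / (p - 1)) * β + k ^ 2 = 0) :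
    (1 - 1 / k) * (√(β * (p - 1)) * √(1 + (β - 1) * (p - 1))) = (β - 1) * (p - 1) := by
  have hp' : 0 < p - 1 := by linarith
  have hβ' : 0 ≤ β - 1 := by linarith
  have hk0 : 0 < k := by linarith
  have hA : 0 ≤ β * (p - 1) := by positivity
  have hB : 0 ≤ 1 + (β - 1) * (p - 1) := by positivity
  have hk' : 0 ≤ 1 - 1 / k := by
    rw [sub_nonneg, div_le_one hk0]; exact hk
  refine (pow_left_inj₀ (by positivity) (by positivity) two_ne_zero).1 ?_
  rw [mul_pow, mul_pow, sq_sqrt hA, sq_sqrt hB]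
  field_simp at hroot ⊢
  linear_combination -hroot

end KrolODE

/-- The ODE part of Krol's theorem: existence of a smooth nondegenerate solution of the
one-dimensional `p`-harmonic spectral equation with least antiperiod `π/k`. -/
theorem stmt_13 (p : ℝ) (hp : 1 < p) (k : ℕ) (hk : 1 ≤ k) (β : ℝ)
    (hβ1 : 1 ≤ β)
    (hβroot : (2 * (k : ℝ) - 1) * β ^ 2
        - ((p * (k : ℝ) ^ 2 + (p - 2) * (2 * (k : ℝ) - 1)) / (p - 1)) * β
        + (k : ℝ) ^ 2 = 0) :
    ∃ ω : ℝ → ℝ, ContDiff ℝ (⊤ : ℕ∞) ω ∧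
      (∀ θ : ℝ, 0 < β ^ 2 * ω θ ^ 2 + (deriv ω θ) ^ 2) ∧
      (∀ θ : ℝ,
        deriv (fun t => (β ^ 2 * ω t ^ 2 + (deriv ω t) ^ 2) ^ ((p - 2) / 2) * deriv ω t) θ
          = -(β * (1 + (β - 1) * (p - 1))
              * (β ^ 2 * ω θ ^ 2 + (deriv ω θ) ^ 2) ^ ((p - 2) / 2) * ω θ)) ∧
      (∀ θ : ℝ, ω (θ + Real.pi / k) = -ω θ) ∧
      ¬∃ T : ℝ, 0 < T ∧ T < Real.pi / k ∧ ∀ θ : ℝ, ω (θ + T) = -ω θ := by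
  have hp' : 0 < p - 1 := by linarith
  have hβ0 : 0 < β := by linarith
  have hβ' : 0 ≤ β - 1 := by linarith
  have hk1 : (1 : ℝ) ≤ k := by exact_mod_cast hk
  have hk0 : (0 : ℝ) < k := by linarith
  obtain ⟨A, hA⟩ : ∃ A, A = β * (p - 1) := ⟨_, rfl⟩
  obtain ⟨B, hB⟩ : ∃ B, B = 1 + (β - 1) * (p - 1) := ⟨_, rfl⟩
  have hA0 : 0 < A := by rw [hA]; positivity
  have hB0 : 0 < B := by rw [hB]; positivity
  have hm0 : (0 : ℝ) ≤ 1 - 1 / k := by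
    rw [sub_nonneg, div_le_one hk0]; exact hk1
  have hm1 : 1 - 1 / (k : ℝ) < 1 := by
    have : 0 < 1 / (k : ℝ) := by positivity
    linarith
  have hperiod : (1 - (1 - 1 / (k : ℝ))) * Real.pi = Real.pi / k := by ring
  have hab := KrolODE.sqrt_mul_sqrt_of_root hp hβ1 hk1 hβroot
  rw [← hA, ← hB] at hab
  have hDeq : ∀ φ, KrolODE.quad A B φ - (β - 1) * (p - 1) = KrolODE.quad (p - 1) 1 φ := by
    intro φ
    rw [hA, hB]
    unfold KrolODE.quad
    linear_combination ((β - 1) * (p - 1)) * Real.sin_sq_add_cos_sq φ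
  have hD0 := KrolODE.quad_pos hp' one_pos
  have hN0 := KrolODE.quad_pos hA0 hB0
  obtain ⟨Φ, hΦsmooth, hΦmono, hΦ0, hΦpi, hΦd⟩ :=
    KrolODE.exists_polar_angle hm0 hm1 (Real.sqrt_pos.2 hA0) (Real.sqrt_pos.2 hB0) (by
      intro φ
      rw [Real.sq_sqrt hA0.le, Real.sq_sqrt hB0.le, hab, hDeq]
      exact hD0 φ)
  simp only [Real.sq_sqrt hA0.le, Real.sq_sqrt hB0.le, hab, hDeq, hperiod] at hΦpi hΦd
  have hpow : ∀ (r θ : ℝ), HasDerivAt (fun t => KrolODE.quad A B (Φ t) ^ r)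
      (KrolODE.quad A B (Φ θ) ^ r * (2 * r * (B - A) * (Real.sin (Φ θ) * Real.cos (Φ θ)))
        / KrolODE.quad (p - 1) 1 (Φ θ)) θ := by
    intro r θ
    have h := ((KrolODE.hasDerivAt_quad A B (Φ θ)).comp θ (hΦd θ)).rpow_const (p := r)
      (Or.inl (hN0 _).ne')
    refine h.congr_deriv ?_
    have h1 := (hN0 (Φ θ)).ne'
    have h2 := (hD0 (Φ θ)).ne'
    simp only [Function.comp_apply]
    rw [Real.rpow_sub_one h1]
    field_simp
  have hω' : ∀ θ, HasDerivAt
      (fun t => KrolODE.quad A B (Φ t) ^ ((β - 1) / 2) * Real.sin (Φ t) / β)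
      (KrolODE.quad A B (Φ θ) ^ ((β - 1) / 2) * Real.cos (Φ θ)) θ := by
    intro θ
    refine (((hpow ((β - 1) / 2) θ).mul (hΦd θ).sin).div_const β).congr_deriv ?_
    have h2 := (hD0 (Φ θ)).ne'
    field_simp
    rw [hA, hB]
    unfold KrolODE.quad
    ring
  have hderiv := funext fun θ => (hω' θ).deriv
  have hR0 : ∀ θ, 0 < KrolODE.quad A B (Φ θ) ^ ((β - 1) / 2) := fun θ =>
    Real.rpow_pos_of_pos (hN0 _) _
  have hflux : ∀ θ, ((KrolODE.quad A B (Φ θ) ^ ((β - 1) / 2)) ^ 2) ^ ((p - 2) / 2)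
      * KrolODE.quad A B (Φ θ) ^ ((β - 1) / 2)
      = KrolODE.quad A B (Φ θ) ^ ((β - 1) * (p - 1) / 2) := by
    intro θ
    rw [← Real.rpow_mul_natCast (hN0 _).le, ← Real.rpow_mul (hN0 _).le,
      ← Real.rpow_add (hN0 _)]
    congr 1
    push_cast
    ring
  refine ⟨fun t => KrolODE.quad A B (Φ t) ^ ((β - 1) / 2) * Real.sin (Φ t) / β,
    ?_, ?_, ?_, ?_, ?_⟩
  · exact ((((KrolODE.contDiff_quad A B).comp hΦsmooth).rpow_const_of_ne
      fun θ => (hN0 _).ne').mul (Real.contDiff_sin.comp hΦsmooth)).div_const β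
  · intro θ
    rw [hderiv, KrolODE.polar_sq hβ0.ne']
    exact pow_pos (hR0 θ) 2
  · intro θ
    simp only [hderiv, KrolODE.polar_sq hβ0.ne', ← mul_assoc, hflux]
    refine ((hpow ((β - 1) * (p - 1) / 2) θ).mul (hΦd θ).cos).deriv.trans ?_
    have h2 := (hD0 (Φ θ)).ne'
    rw [← hB, ← hflux]
    field_simp
    rw [hA, hB]
    unfold KrolODE.quad
    ring
  · intro θ
    simp only [hΦpi, KrolODE.quad_add_pi, Real.sin_add_pi]
    ring
  · rintro ⟨T, hT0, hT, h⟩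
    have hΦT0 : 0 < Φ T := hΦ0 ▸ hΦmono hT0
    have hΦTpi : Φ T < Real.pi := by
      have := hΦmono hT
      rwa [← zero_add (Real.pi / k), hΦpi, hΦ0, zero_add] at this
    have hT' := h 0
    simp only [zero_add, hΦ0, Real.sin_zero, mul_zero, zero_div, neg_zero] at hT'
    exact (div_pos (mul_pos (hR0 T) (Real.sin_pos_of_pos_of_lt_pi hΦT0 hΦTpi)) hβ0).ne' hT'
end
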